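/- arXiv:math/0103153 — 2 statements merged into one kernel-verified Lean document; each statement's English description precedes it below -/
import Mathlib

section
/- For all natural numbers n ≥ 2 and k ≥ 1: 𝔳̄_n^const(k) = 𝔳_n^const(k) = 𝔳_2^const(k). That is, the least cardinality of a family of predictors that weakly k-constantly predicts all of n^ω, the least cardinality of a family of predictors that k-constantly predicts all of n^ω, and the least cardinality of a family of predictors that k-constantly predicts all of 2^ω all coincide. -/
open Cardinal

/-- The initial segment `x↾i` of `x : n^ω`, as a finite sequence. -/
def seg {n : ℕ} (x : ℕ → Fin n) (i : ℕ) : List (Fin n) :=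
  List.ofFn (fun j : Fin i => x j)

/-- `π` k-constantly predicts `x`: for all but finitely many `m` there is
`i ∈ [m, m+k)` with `x i = π (x↾i)`. -/
def KPred {n : ℕ} (k : ℕ) (π : List (Fin n) → Fin n) (x : ℕ → Fin n) : Prop :=
  ∃ N, ∀ m, N ≤ m → ∃ i, m ≤ i ∧ i < m + k ∧ x i = π (seg x i)

/-- `π` weakly k-constantly predicts `x`: for all but finitely many `m` there is
`i < k` with `x (m*k+i) = π (x↾(m*k+i))`. -/
def WPred {n : ℕ} (k : ℕ) (π : List (Fin n) → Fin n) (x : ℕ → Fin n) : Prop :=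
  ∃ N, ∀ m, N ≤ m → ∃ i, i < k ∧ x (m * k + i) = π (seg x (m * k + i))

/-- The k-constant prediction number 𝔳ₙᶜᵒⁿˢᵗ(k). -/
noncomputable def vConst (n k : ℕ) : Cardinal :=
  sInf { c | ∃ P : Set (List (Fin n) → Fin n), #P = c ∧
    ∀ x : ℕ → Fin n, ∃ π ∈ P, KPred k π x }

/-- The weak k-constant prediction number 𝔳̄ₙᶜᵒⁿˢᵗ(k). -/
noncomputable def vBar (n k : ℕ) : Cardinal :=
  sInf { c | ∃ P : Set (List (Fin n) → Fin n), #P = c ∧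
    ∀ x : ℕ → Fin n, ∃ π ∈ P, WPred k π x }

/-- The k-constant evasion number 𝔢ₙᶜᵒⁿˢᵗ(k). -/
noncomputable def eConst (n k : ℕ) : Cardinal :=
  sInf { c | ∃ F : Set (ℕ → Fin n), #F = c ∧
    ∀ π : List (Fin n) → Fin n, ∃ x ∈ F, ¬ KPred k π x }

/-- The weak k-constant evasion number 𝔢̄ₙᶜᵒⁿˢᵗ(k). -/
noncomputable def eBar (n k : ℕ) : Cardinal :=
  sInf { c | ∃ F : Set (ℕ → Fin n), #F = c ∧
    ∀ π : List (Fin n) → Fin n, ∃ x ∈ F, ¬ WPred k π x }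

/-- A family `g` of functions on sequences is local when `g m x` depends only on the values
of `x` below `m`. -/
def IsLocal {α β : Type} (g : ℕ → (ℕ → α) → β) : Prop :=
  ∀ m x y, (∀ j < m, x j = y j) → g m x = g m y

lemma seg_congr {n m : ℕ} {x y : ℕ → Fin n} (h : ∀ j < m, x j = y j) : seg x m = seg y m := by
  unfold seg
  congr 1
  funext j
  exact h j j.2

/-- A local function is induced by a function on finite sequences. -/
lemma IsLocal.exists_predictor {n : ℕ} [NeZero n] {g : ℕ → (ℕ → Fin n) → Fin n}
    (hg : IsLocal g) : ∃ π : List (Fin n) → Fin n, ∀ x m, π (seg x m) = g m x := by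
  refine ⟨fun l => g l.length fun j => l.getD j 0, fun x m => ?_⟩
  have hlen : (seg x m).length = m := by simp [seg]
  simp only [hlen]
  apply hg
  intro j hj
  simp [seg, List.getD_eq_getElem?_getD, hj]

/-- A sequence may be defined by a local recursion. -/
lemma IsLocal.exists_fixed {α : Type} [Inhabited α] {g : ℕ → (ℕ → α) → α} (hg : IsLocal g) :
    ∃ y : ℕ → α, ∀ t, y t = g t y := by
  let s : ℕ → ℕ → α := fun t => t.rec (fun _ => default)
    fun m z => Function.update z m (g m z)
  have hs : ∀ t, s (t + 1) = Function.update (s t) t (g t (s t)) := fun t => rfl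
  have key : ∀ t j, j < t → s t j = s (j + 1) j := by
    intro t
    induction t with
    | zero => intro j hj; omega
    | succ t ih =>
      intro j hj
      rcases Nat.lt_succ_iff_lt_or_eq.1 hj with h | rfl
      · rw [hs, Function.update_of_ne (by omega), ih j h]
      · rfl
  refine ⟨fun t => s (t + 1) t, fun t => ?_⟩
  change s (t + 1) t = _
  rw [hs, Function.update_self]
  exact hg _ _ _ fun j hj => key t j hj

lemma one_sub_ne_self (a : Fin 2) : 1 - a ≠ a := by
  revert a; decide

/-- A weakly predicting family of predictors on `2^ω` is infinite. -/
lemma aleph0_le_of_wPred {k : ℕ} (P : Set (List (Fin 2) → Fin 2))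
    (hP : ∀ x : ℕ → Fin 2, ∃ π ∈ P, WPred k π x) : ℵ₀ ≤ #P := by
  by_contra hlt
  have hc : P.Countable := Cardinal.le_aleph0_iff_set_countable.1 (not_le.1 hlt).le
  obtain ⟨π₀, hπ₀, -⟩ := hP fun _ => 0
  obtain ⟨p, rfl⟩ := hc.exists_eq_range ⟨π₀, hπ₀⟩
  have hloc : IsLocal fun t (y : ℕ → Fin 2) => 1 - p (t / k).unpair.1 (seg y t) := by
    intro t x y h
    simp only [seg_congr h]
  obtain ⟨y, hy⟩ := hloc.exists_fixed
  obtain ⟨_, ⟨a, rfl⟩, N, hN⟩ := hP y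
  obtain ⟨i, hi, h⟩ := hN (Nat.pair a N) (Nat.right_le_pair a N)
  have h2 := hy (Nat.pair a N * k + i)
  have hdiv : (Nat.pair a N * k + i) / k = Nat.pair a N := by
    rw [mul_comm, Nat.mul_add_div (by omega), Nat.div_eq_of_lt hi, add_zero]
  simp only [hdiv, Nat.unpair_pair] at h2
  exact one_sub_ne_self _ (h2.symm.trans h)

/-- `S` is a family of local slaloms of width less than `s` capturing every sequence in `α`. -/
structure Captures {α ι : Type} (s : ℕ) (S : ι → ℕ → (ℕ → α) → Finset α) : Prop where
  isLocal : ∀ i, IsLocal (S i)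
  card_lt : ∀ i m z, (S i m z).card < s
  captures : ∀ z : ℕ → α, ∃ i, ∃ N, ∀ m, N ≤ m → z m ∈ S i m z

lemma exists_surj_on {α β : Type} [Fintype β] [Nonempty β] (C : Finset α) :
    ∃ f : α → β, Fintype.card β ≤ C.card → ∀ b, ∃ a ∈ C, f a = b := by
  by_cases h : Fintype.card β ≤ C.card
  · obtain ⟨e⟩ : Nonempty (β ↪ C) :=
      Function.Embedding.nonempty_of_card_le (by simpa using h)
    have hinj : Function.Injective fun b => (e b : α) :=
      Subtype.val_injective.comp e.injective
    exact ⟨Function.invFun fun b => (e b : α), fun _ b =>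
      ⟨e b, (e b).2, Function.leftInverse_invFun hinj b⟩⟩
  · exact ⟨fun _ => Classical.arbitrary β, fun h' => absurd h' h⟩

/-- The binary sequence whose block number `m` is the code of `z m` relative to `S m z`. -/
def blockCode {α : Type} {k : ℕ} (hk : 0 < k) (f : Finset α → α → Fin k → Fin 2)
    (S : ℕ → (ℕ → α) → Finset α) (z : ℕ → α) (t : ℕ) : Fin 2 :=
  f (S (t / k) z) (z (t / k)) ⟨t % k, Nat.mod_lt _ hk⟩

lemma blockCode_congr {α : Type} {k : ℕ} (hk : 0 < k) (f : Finset α → α → Fin k → Fin 2)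
    {S : ℕ → (ℕ → α) → Finset α} (hS : IsLocal S) {m : ℕ} {z z' : ℕ → α}
    (h : ∀ j < m, z j = z' j) {t : ℕ} (ht : t < m * k) :
    blockCode hk f S z t = blockCode hk f S z' t := by
  have hd : t / k < m := (Nat.div_lt_iff_lt_mul hk).2 ht
  unfold blockCode
  rw [h _ hd, hS _ z z' fun j hj => h j (hj.trans hd)]

open Classical in
/-- The part of `S m z` compatible with weak prediction of the block code by `π`. -/
noncomputable def compatible {α : Type} {k : ℕ} (hk : 0 < k) (f : Finset α → α → Fin k → Fin 2)
    (S : ℕ → (ℕ → α) → Finset α) (π : List (Fin 2) → Fin 2) (m : ℕ) (z : ℕ → α) : Finset α :=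
  (S m z).filter fun a => ∃ i < k, blockCode hk f S (Function.update z m a) (m * k + i) =
    π (seg (blockCode hk f S (Function.update z m a)) (m * k + i))

lemma isLocal_compatible {α : Type} {k : ℕ} (hk : 0 < k) (f : Finset α → α → Fin k → Fin 2)
    {S : ℕ → (ℕ → α) → Finset α} (hS : IsLocal S) (π : List (Fin 2) → Fin 2) :
    IsLocal (compatible hk f S π) := by
  classical
  intro m z z' h
  unfold compatible
  rw [hS m z z' h]
  apply Finset.filter_congr
  intro a _
  have hu : ∀ j < m + 1, Function.update z m a j = Function.update z' m a j := by
    intro j hj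
    by_cases hjm : j = m
    · subst hjm; simp
    · rw [Function.update_of_ne hjm, Function.update_of_ne hjm, h j (by omega)]
  have hc : ∀ t < (m + 1) * k, blockCode hk f S (Function.update z m a) t =
      blockCode hk f S (Function.update z' m a) t :=
    fun t ht => blockCode_congr hk f hS hu ht
  refine exists_congr fun i => and_congr_right fun hi => ?_
  have hlt : m * k + i < (m + 1) * k := by rw [add_mul]; omega
  rw [hc _ hlt, seg_congr fun j hj => hc j (hj.trans hlt)]

lemma card_compatible_lt {α : Type} {k : ℕ} (hk : 0 < k) {f : Finset α → α → Fin k → Fin 2}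
    (hf : ∀ C : Finset α, 2 ^ k ≤ C.card → ∀ b, ∃ a ∈ C, f C a = b)
    {S : ℕ → (ℕ → α) → Finset α} (hS : IsLocal S) (π : List (Fin 2) → Fin 2) (m : ℕ)
    (z : ℕ → α) (hcard : 2 ^ k ≤ (S m z).card) :
    (compatible hk f S π m z).card < (S m z).card := by
  classical
  have hloc : IsLocal fun t (y : ℕ → Fin 2) =>
      if t < m * k then blockCode hk f S z t else 1 - π (seg y t) := by
    intro t x y h
    simp only [seg_congr h]
  obtain ⟨y, hy⟩ := hloc.exists_fixed
  obtain ⟨a, haC, ha⟩ := hf _ hcard fun i => y (m * k + i)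
  have hu : ∀ j < m, Function.update z m a j = z j :=
    fun j hj => Function.update_of_ne (by omega) _ _
  have hcode : ∀ t < (m + 1) * k, blockCode hk f S (Function.update z m a) t = y t := by
    intro t ht
    by_cases htm : t < m * k
    · rw [blockCode_congr hk f hS hu htm, hy, if_pos htm]
    · have hlt : t - m * k < k := by rw [add_mul] at ht; omega
      obtain ⟨i, hi, rfl⟩ : ∃ i < k, t = m * k + i := ⟨t - m * k, hlt, by omega⟩
      have hdiv : (m * k + i) / k = m := by
        rw [mul_comm, Nat.mul_add_div hk, Nat.div_eq_of_lt hi, add_zero]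
      have hmod : (m * k + i) % k = i := by
        rw [mul_comm, Nat.mul_add_mod, Nat.mod_eq_of_lt hi]
      simp only [blockCode, hdiv, hmod, Function.update_self, hS m _ _ hu, ha]
  apply Finset.card_lt_card
  refine Finset.filter_ssubset.2 ⟨a, haC, ?_⟩
  rintro ⟨i, hi, h⟩
  have hlt : m * k + i < (m + 1) * k := by rw [add_mul]; omega
  rw [hcode _ hlt, seg_congr fun j hj => hcode j (hj.trans hlt), hy, if_neg (by omega)] at h
  exact one_sub_ne_self _ h

/-- Weakly `k`-predicting families on `2^ω` give capturing slaloms of width less than `2 ^ k`. -/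
lemma exists_captures {α : Type} [Fintype α] {k : ℕ} (hk : 0 < k)
    (P : Set (List (Fin 2) → Fin 2)) (hP : ∀ x : ℕ → Fin 2, ∃ π ∈ P, WPred k π x) :
    ∃ (ι : Type) (S : ι → ℕ → (ℕ → α) → Finset α), #ι ≤ #P ∧ Captures (2 ^ k) S := by
  have hinf := aleph0_le_of_wPred P hP
  have main : ∀ d : ℕ, ∃ (ι : Type) (S : ι → ℕ → (ℕ → α) → Finset α),
      #ι ≤ #P ∧ Captures (2 ^ k + (Fintype.card α - d)) S := by
    intro d
    induction d with
    | zero =>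
      refine ⟨Unit, fun _ _ _ => Finset.univ, ?_, fun _ _ _ _ _ => rfl, fun _ _ _ => ?_,
        fun z => ⟨(), 0, fun m _ => Finset.mem_univ _⟩⟩
      · simpa using Cardinal.one_le_aleph0.trans hinf
      · have : 0 < 2 ^ k := by positivity
        rw [Finset.card_univ]
        omega
    | succ d ih =>
      obtain ⟨ι, S, hι, hS⟩ := ih
      choose f hf using fun C : Finset α => exists_surj_on (β := Fin k → Fin 2) C
      replace hf : ∀ C : Finset α, 2 ^ k ≤ C.card → ∀ b, ∃ a ∈ C, f C a = b :=
        fun C hC => hf C (by simpa using hC)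
      refine ⟨ι × P, fun q => compatible hk f (S q.1) q.2, ?_,
        fun q => isLocal_compatible hk f (hS.isLocal q.1) _, fun q m z => ?_, fun z => ?_⟩
      · rw [Cardinal.mk_prod, Cardinal.lift_id, Cardinal.lift_id]
        exact (mul_le_mul_left hι _).trans (Cardinal.mul_eq_self hinf).le
      · have h1 := hS.card_lt q.1 m z
        have h2 : (compatible hk f (S q.1) q.2 m z).card ≤ (S q.1 m z).card :=
          Finset.card_filter_le _ _
        by_cases hc : 2 ^ k ≤ (S q.1 m z).card
        · have := card_compatible_lt hk hf (hS.isLocal q.1) q.2 m z hc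
          omega
        · omega
      · obtain ⟨i, N, hN⟩ := hS.captures z
        obtain ⟨π, hπ, M, hM⟩ := hP (blockCode hk f (S i) z)
        refine ⟨(i, ⟨π, hπ⟩), max N M, fun m hm => ?_⟩
        simp only [compatible, Finset.mem_filter, Function.update_eq_self]
        exact ⟨hN m (le_trans (le_max_left _ _) hm), hM m (le_trans (le_max_right _ _) hm)⟩
  obtain ⟨ι, S, hι, hS⟩ := main (Fintype.card α)
  exact ⟨ι, S, hι, by simpa using hS⟩

/-- The windows of length `k` starting at arbitrary positions can be captured as well. -/
lemma exists_window_captures (n : ℕ) {k : ℕ} (hk : 0 < k) (P : Set (List (Fin 2) → Fin 2))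
    (hP : ∀ x : ℕ → Fin 2, ∃ π ∈ P, WPred k π x) :
    ∃ (ι : Type) (T : ι → ℕ → (ℕ → Fin n) → Finset (Fin k → Fin n)), #ι ≤ #P ∧
      (∀ i, IsLocal (T i)) ∧ (∀ i t x, (T i t x).card < 2 ^ k) ∧
      ∀ x, ∃ i, ∃ N, ∀ t, N ≤ t → (fun j : Fin k => x (t + j)) ∈ T i t x := by
  have hinf := aleph0_le_of_wPred P hP
  obtain ⟨ι, S, hι, hS⟩ := exists_captures (α := Fin k → Fin n) hk P hP
  refine ⟨Fin k → ι, fun I t x => S (I ⟨t % k, Nat.mod_lt _ hk⟩) (t / k)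
    fun m j => x (t % k + m * k + j), ?_, fun I t x y h => ?_, fun I t x => hS.card_lt _ _ _,
    fun x => ?_⟩
  · have hpow : #(Fin k → ι) = #ι ^ k := by simp
    rw [hpow]
    exact (pow_le_pow_left' hι k).trans (Cardinal.power_nat_le hinf)
  · apply hS.isLocal
    intro m hm
    funext j
    apply h
    have h1 : (m + 1) * k ≤ t / k * k := Nat.mul_le_mul_right k hm
    have h2 := Nat.div_add_mod' t k
    have h3 := j.2
    rw [add_mul] at h1
    omega
  · choose I N hN using fun r : Fin k => hS.captures fun m j => x (r + m * k + j)
    refine ⟨I, (Finset.univ.sup N) * k, fun t ht => ?_⟩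
    have h := hN ⟨t % k, Nat.mod_lt _ hk⟩ (t / k)
      ((Finset.le_sup (f := N) (Finset.mem_univ _)).trans ((Nat.le_div_iff_mul_le hk).2 ht))
    simpa only [Nat.mod_add_div'] using h

section Majority

variable {n k : ℕ}

/-- The windows in `C`, placed at position `s`, that agree with `x` below `t`. -/
def agreeing (C : Finset (Fin k → Fin n)) (s t : ℕ) (x : ℕ → Fin n) :
    Finset (Fin k → Fin n) :=
  C.filter fun w => ∀ j : Fin k, s + j < t → w j = x (s + j)

/-- The windows in `C`, placed at position `s`, that take the value `v` at `t`. -/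
def valued (C : Finset (Fin k → Fin n)) (s t : ℕ) (v : Fin n) : Finset (Fin k → Fin n) :=
  C.filter fun w => ∀ j : Fin k, s + j = t → w j = v

lemma agreeing_succ (C : Finset (Fin k → Fin n)) (s t : ℕ) (x : ℕ → Fin n) :
    agreeing C s (t + 1) x = valued (agreeing C s t x) s t (x t) := by
  ext w
  simp only [agreeing, valued, Finset.mem_filter, and_assoc]
  refine and_congr_right fun _ => ⟨fun h => ⟨fun j hj => h j (by omega), fun j hj => ?_⟩,
    fun h j hj => ?_⟩
  · rw [h j (by omega), hj]
  · rcases Nat.lt_succ_iff_lt_or_eq.1 hj with h' | h'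
    · exact h.1 j h'
    · rw [h.2 j h', h']

variable [NeZero n]

lemma exists_majority (C : Finset (Fin k → Fin n)) (s t : ℕ) :
    ∃ v, ∀ u, (valued C s t u).card ≤ (valued C s t v).card :=
  Finite.exists_max fun v => (valued C s t v).card

/-- The most frequent value at `t` among the windows in `C` placed at `s`. -/
noncomputable def majority (C : Finset (Fin k → Fin n)) (s t : ℕ) : Fin n :=
  (exists_majority C s t).choose

lemma two_mul_card_valued_le {C : Finset (Fin k → Fin n)} {s t : ℕ} {u : Fin n} (hs : s ≤ t)
    (ht : t < s + k) (hu : u ≠ majority C s t) : 2 * (valued C s t u).card ≤ C.card := by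
  have hmax := (exists_majority C s t).choose_spec u
  change _ ≤ (valued C s t (majority C s t)).card at hmax
  have hdisj : Disjoint (valued C s t u) (valued C s t (majority C s t)) := by
    rw [Finset.disjoint_left]
    intro w h1 h2
    have h1' := (Finset.mem_filter.1 h1).2 ⟨t - s, by omega⟩ (by simp; omega)
    have h2' := (Finset.mem_filter.1 h2).2 ⟨t - s, by omega⟩ (by simp; omega)
    exact hu (h1'.symm.trans h2')
  have hsub : valued C s t u ∪ valued C s t (majority C s t) ⊆ C :=
    Finset.union_subset (Finset.filter_subset _ _) (Finset.filter_subset _ _)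
  have := Finset.card_le_card hsub
  rw [Finset.card_union_of_disjoint hdisj] at this
  omega

variable (T : ℕ → (ℕ → Fin n) → Finset (Fin k → Fin n))

/-- The majority guess at `t` from the window set attached to position `s`. -/
noncomputable def guessFrom (s t : ℕ) (x : ℕ → Fin n) : Fin n :=
  majority (agreeing (T s x) s t x) s t

/-- The start of the window in use at time `t`; a new window starts after each correct guess
and whenever the current window is exhausted. -/
noncomputable def windowStart : ℕ → (ℕ → Fin n) → ℕ
  | 0, _ => 0
  | t + 1, x =>
    if x t = guessFrom T (windowStart t x) t x ∨ windowStart t x + k ≤ t + 1 then t + 1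
    else windowStart t x

variable {T}

lemma windowStart_le (t : ℕ) (x : ℕ → Fin n) : windowStart T t x ≤ t := by
  induction t with
  | zero => simp [windowStart]
  | succ t ih => rw [windowStart]; split_ifs <;> omega

lemma lt_windowStart_add (hk : 0 < k) (t : ℕ) (x : ℕ → Fin n) :
    t < windowStart T t x + k := by
  induction t with
  | zero => omega
  | succ t ih =>
    rw [windowStart]
    split_ifs with h
    · omega
    · push Not at h
      omega

lemma guessFrom_congr (hT : IsLocal T) {s t : ℕ} (hs : s ≤ t) {x y : ℕ → Fin n}
    (h : ∀ j < t, x j = y j) : guessFrom T s t x = guessFrom T s t y := by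
  have : agreeing (T s x) s t x = agreeing (T s y) s t y := by
    unfold agreeing
    rw [hT s x y fun j hj => h j (by omega)]
    refine Finset.filter_congr fun w _ => forall_congr' fun j => ?_
    exact forall_congr' fun hj => by rw [h _ hj]
  rw [guessFrom, guessFrom, this]

lemma isLocal_windowStart (hT : IsLocal T) : IsLocal (windowStart T) := by
  intro t
  induction t with
  | zero => intro x y _; rfl
  | succ t ih =>
    intro x y h
    have h' : ∀ j < t, x j = y j := fun j hj => h j (by omega)
    rw [windowStart, windowStart, ih x y h', h t (by omega),
      guessFrom_congr hT (windowStart_le t y) h']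

lemma isLocal_guess (hT : IsLocal T) :
    IsLocal fun t x => guessFrom T (windowStart T t x) t x := by
  intro t x y h
  simp only [isLocal_windowStart hT t x y h]
  exact guessFrom_congr hT (windowStart_le t y) h

lemma card_agreeing_mul_lt (hcard : ∀ t x, (T t x).card < 2 ^ k) (t : ℕ)
    (x : ℕ → Fin n) :
    (agreeing (T (windowStart T t x) x) (windowStart T t x) t x).card *
      2 ^ (t - windowStart T t x) < 2 ^ k := by
  have fresh : ∀ s, (agreeing (T s x) s s x).card * 2 ^ (s - s) < 2 ^ k := fun s => by
    rw [Nat.sub_self, pow_zero, mul_one]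
    exact (Finset.card_filter_le _ _).trans_lt (hcard s x)
  induction t with
  | zero => exact fresh 0
  | succ t ih =>
    rw [windowStart]
    split_ifs with h
    · exact fresh (t + 1)
    · push Not at h
      have hle := windowStart_le (T := T) t x
      have h2 := two_mul_card_valued_le hle (by omega) h.1
      rw [← agreeing_succ] at h2
      refine lt_of_le_of_lt ?_ ih
      rw [Nat.sub_add_comm hle, pow_succ, mul_comm (2 ^ _) 2, ← mul_assoc, mul_comm _ 2]
      exact Nat.mul_le_mul_right _ h2

/-- An exhausted window whose set contains the true window was left by a correct guess. -/
lemma guess_eq_of_exhausted (hk : 0 < k) (hcard : ∀ t x, (T t x).card < 2 ^ k) {t : ℕ}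
    {x : ℕ → Fin n}
    (hmem : (fun j : Fin k => x (windowStart T t x + j)) ∈ T (windowStart T t x) x)
    (ht : t + 1 = windowStart T t x + k) :
    x t = guessFrom T (windowStart T t x) t x := by
  by_contra hne
  have h1 := card_agreeing_mul_lt hcard t x
  have hle := windowStart_le (T := T) t x
  have h2 := two_mul_card_valued_le hle (by omega) hne
  rw [← agreeing_succ] at h2
  have hpos : 0 < (agreeing (T (windowStart T t x) x) (windowStart T t x) (t + 1) x).card :=
    Finset.card_pos.2 ⟨_, Finset.mem_filter.2 ⟨hmem, fun _ _ => rfl⟩⟩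
  have hk' : k = (t - windowStart T t x) + 1 := by omega
  have h3 : 2 ^ k = 2 * 2 ^ (t - windowStart T t x) := by
    conv_lhs => rw [hk']
    rw [pow_succ, mul_comm]
  rw [h3] at h1
  have := lt_of_mul_lt_mul_right h1 (Nat.zero_le _)
  omega

/-- Window capturing sets of size less than `2 ^ k` yield a `k`-constant predictor. -/
lemma exists_kPred (hk : 0 < k) (hT : IsLocal T) (hcard : ∀ t x, (T t x).card < 2 ^ k) :
    ∃ π : List (Fin n) → Fin n, ∀ x,
      (∃ N, ∀ t, N ≤ t → (fun j : Fin k => x (t + j)) ∈ T t x) → KPred k π x := by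
  obtain ⟨π, hπ⟩ := (isLocal_guess hT).exists_predictor
  refine ⟨π, fun x ⟨N, hN⟩ => ⟨N + k, fun m hm => ?_⟩⟩
  by_contra! hmiss
  simp only [hπ] at hmiss
  have hlt := lt_windowStart_add (T := T) hk m x
  have hle := windowStart_le (T := T) m x
  have hstay : ∀ d, m + d < windowStart T m x + k →
      windowStart T (m + d) x = windowStart T m x := by
    intro d
    induction d with
    | zero => intro _; rfl
    | succ d ih =>
      intro hd
      have hd' := ih (by omega)
      have hmd := hmiss (m + d) (by omega) (by omega)
      rw [← add_assoc, windowStart, if_neg, hd']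
      push Not
      exact ⟨hmd, by omega⟩
  obtain ⟨d, hd⟩ : ∃ d, m + d + 1 = windowStart T m x + k :=
    ⟨windowStart T m x + k - 1 - m, by omega⟩
  have hst := hstay d (by omega)
  refine hmiss (m + d) (by omega) (by omega) (guess_eq_of_exhausted hk hcard ?_ ?_)
  · rw [hst]
    exact hN _ (by omega)
  · rw [hst]
    exact hd

end Majority

/-- Every sequence is predicted by some predictor. -/
lemma exists_predictor_eq {n : ℕ} (x : ℕ → Fin n) :
    ∃ π : List (Fin n) → Fin n, ∀ i, x i = π (seg x i) :=
  ⟨fun l => x l.length, fun i => by simp [seg]⟩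

lemma KPred.wPred {n k : ℕ} {π : List (Fin n) → Fin n} {x : ℕ → Fin n} (hk : 1 ≤ k)
    (h : KPred k π x) : WPred k π x := by
  obtain ⟨N, hN⟩ := h
  refine ⟨N, fun m hm => ?_⟩
  obtain ⟨i, h1, h2, h3⟩ := hN (m * k) (hm.trans (Nat.le_mul_of_pos_right m hk))
  exact ⟨i - m * k, by omega, by rwa [Nat.add_sub_cancel' h1]⟩

lemma exists_vConst_family (n : ℕ) {k : ℕ} (hk : 1 ≤ k) :
    ∃ P : Set (List (Fin n) → Fin n), #P = vConst n k ∧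
      ∀ x : ℕ → Fin n, ∃ π ∈ P, KPred k π x := by
  refine csInf_mem (s := { c | ∃ P : Set (List (Fin n) → Fin n), #P = c ∧
    ∀ x : ℕ → Fin n, ∃ π ∈ P, KPred k π x }) ⟨_, Set.univ, rfl, fun x => ?_⟩
  obtain ⟨π, hπ⟩ := exists_predictor_eq x
  exact ⟨π, trivial, 0, fun m _ => ⟨m, le_rfl, by omega, hπ m⟩⟩

lemma vBar_le_vConst (n : ℕ) {k : ℕ} (hk : 1 ≤ k) : vBar n k ≤ vConst n k := by
  obtain ⟨P, hc, hP⟩ := exists_vConst_family n hk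
  exact csInf_le' ⟨P, hc, fun x => (hP x).imp fun π h => ⟨h.1, h.2.wPred hk⟩⟩

lemma exists_vBar_family (n : ℕ) {k : ℕ} (hk : 1 ≤ k) :
    ∃ P : Set (List (Fin n) → Fin n), #P = vBar n k ∧
      ∀ x : ℕ → Fin n, ∃ π ∈ P, WPred k π x := by
  obtain ⟨P, -, hP⟩ := exists_vConst_family n hk
  exact csInf_mem (s := { c | ∃ P : Set (List (Fin n) → Fin n), #P = c ∧
    ∀ x : ℕ → Fin n, ∃ π ∈ P, WPred k π x })
    ⟨_, P, rfl, fun x => (hP x).imp fun π h => ⟨h.1, h.2.wPred hk⟩⟩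

lemma vBar_two_le_vBar {n k : ℕ} (hn : 2 ≤ n) (hk : 1 ≤ k) : vBar 2 k ≤ vBar n k := by
  obtain ⟨P, hc, hP⟩ := exists_vBar_family n hk
  let e : Fin 2 → Fin n := Fin.castLE hn
  have he : Function.Injective e := Fin.castLE_injective hn
  let F : (List (Fin n) → Fin n) → List (Fin 2) → Fin 2 :=
    fun π l => Function.invFun e (π (l.map e))
  refine le_trans (csInf_le' ⟨F '' P, rfl, fun x => ?_⟩) (Cardinal.mk_image_le.trans hc.le)
  obtain ⟨π, hπ, N, hN⟩ := hP (e ∘ x)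
  refine ⟨F π, Set.mem_image_of_mem F hπ, N, fun m hm => ?_⟩
  obtain ⟨i, hi, h⟩ := hN m hm
  have hseg : seg (e ∘ x) (m * k + i) = (seg x (m * k + i)).map e := by
    simp only [seg, List.map_ofFn]
    rfl
  refine ⟨i, hi, ?_⟩
  rw [hseg] at h
  change _ = Function.invFun e _
  rw [← h]
  exact (Function.leftInverse_invFun he _).symm

lemma vConst_le_vBar_two {n k : ℕ} (hn : 2 ≤ n) (hk : 1 ≤ k) : vConst n k ≤ vBar 2 k := by
  have : NeZero n := ⟨by omega⟩
  obtain ⟨P, hc, hP⟩ := exists_vBar_family 2 hk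
  obtain ⟨ι, T, hι, hT, hcard, hcap⟩ := exists_window_captures n hk P hP
  choose π hπ using fun i => exists_kPred hk (hT i) (hcard i)
  refine le_trans (csInf_le' ⟨Set.range π, rfl, fun x => ?_⟩)
    (Cardinal.mk_range_le.trans (hι.trans hc.le))
  obtain ⟨i, hi⟩ := hcap x
  exact ⟨π i, Set.mem_range_self i, hπ i x hi⟩

/-- Theorem 1.2: `𝔳̄ₙᶜᵒⁿˢᵗ(k) = 𝔳ₙᶜᵒⁿˢᵗ(k) = 𝔳₂ᶜᵒⁿˢᵗ(k)` for all `n ≥ 2`, `k ≥ 1`. -/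
theorem stmt4 (n k : ℕ) (hn : 2 ≤ n) (hk : 1 ≤ k) :
    vBar n k = vConst n k ∧ vConst n k = vConst 2 k := by
  have h1 := vBar_le_vConst n hk
  have h2 := vBar_two_le_vBar hn hk
  have h3 := vConst_le_vBar_two hn hk
  exact ⟨le_antisymm h1 (h3.trans h2), le_antisymm (h3.trans (vBar_le_vConst 2 hk))
    ((vConst_le_vBar_two le_rfl hk).trans (h2.trans h1))⟩
end

section
/- For every natural number n ≥ 2, the supremum over k ≥ 1 of the cardinals 𝔢_n^const(k) equals the supremum over k ≥ 1 of the cardinals 𝔢_2^const(k): sup{ 𝔢_n^const(k) : k ∈ ω, k ≥ 1 } = sup{ 𝔢_2^const(k) : k ∈ ω, k ≥ 1 }. -/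
open Cardinal

theorem seg_succ {n : ℕ} (x : ℕ → Fin n) (i : ℕ) : seg x (i + 1) = seg x i ++ [x i] := by
  rw [seg, seg, List.ofFn_succ', List.concat_eq_append]
  rfl

theorem map_seg {n m : ℕ} (f : Fin n → Fin m) (x : ℕ → Fin n) (i : ℕ) :
    (seg x i).map f = seg (fun j => f (x j)) i := by
  simp [seg, List.map_ofFn, Function.comp_def]

/-- Every predictor is wrong everywhere on some sequence. -/
theorem exists_forall_ne_predictor {n : ℕ} (hn : 2 ≤ n) (π : List (Fin n) → Fin n) :
    ∃ x : ℕ → Fin n, ∀ i, x i ≠ π (seg x i) := by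
  have : Nontrivial (Fin n) := Fin.nontrivial_iff_two_le.2 hn
  choose g hg using fun a : Fin n => exists_ne a
  let s : ℕ → List (Fin n) := fun i => Nat.rec [] (fun _ l => l ++ [g (π l)]) i
  have hs : ∀ i, seg (fun j => g (π (s j))) i = s i := by
    intro i
    induction i with
    | zero => simp [seg, s]
    | succ i ih => rw [seg_succ, ih]
  exact ⟨fun j => g (π (s j)), fun i => by rw [hs]; exact hg _⟩

theorem eConst_le {n k : ℕ} (F : Set (ℕ → Fin n))
    (hF : ∀ π : List (Fin n) → Fin n, ∃ x ∈ F, ¬ KPred k π x) : eConst n k ≤ #F :=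
  csInf_le' ⟨F, rfl, hF⟩

theorem exists_predictor_of_lt_eConst {n k : ℕ} {F : Set (ℕ → Fin n)} (hF : #F < eConst n k) :
    ∃ π : List (Fin n) → Fin n, ∀ x ∈ F, KPred k π x := by
  by_contra! h
  exact (eConst_le F h).not_gt hF

theorem exists_mk_eq_eConst {n : ℕ} (hn : 2 ≤ n) (k : ℕ) :
    ∃ F : Set (ℕ → Fin n), #F = eConst n k ∧
      ∀ π : List (Fin n) → Fin n, ∃ x ∈ F, ¬ KPred k π x := by
  refine csInf_mem (s := { c | ∃ F : Set (ℕ → Fin n), #F = c ∧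
    ∀ π : List (Fin n) → Fin n, ∃ x ∈ F, ¬ KPred k π x }) ⟨_, Set.univ, rfl, fun π => ?_⟩
  obtain ⟨x, hx⟩ := exists_forall_ne_predictor hn π
  refine ⟨x, trivial, fun ⟨N, h⟩ => ?_⟩
  obtain ⟨i, -, -, hi⟩ := h N le_rfl
  exact hx i hi

theorem eConst_anti {n m : ℕ} (hm : 2 ≤ m) (h : m ≤ n) (k : ℕ) : eConst n k ≤ eConst m k := by
  obtain ⟨F, hF, hev⟩ := exists_mk_eq_eConst hm k
  rw [← hF]
  refine (eConst_le ((fun x i => Fin.castLE h (x i)) '' F) fun π => ?_).trans mk_image_le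
  have : NeZero m := ⟨by omega⟩
  obtain ⟨x, hxF, hx⟩ := hev fun s => Function.invFun (Fin.castLE h) (π (s.map (Fin.castLE h)))
  refine ⟨_, ⟨x, hxF, rfl⟩, fun ⟨N, hN⟩ => hx ⟨N, fun l hl => ?_⟩⟩
  obtain ⟨i, h₁, h₂, hi⟩ := hN l hl
  refine ⟨i, h₁, h₂, ?_⟩
  simp only [map_seg]
  rw [← hi]
  exact (Function.leftInverse_invFun (Fin.castLE_injective h) _).symm

/-- Whether a letter is `0`, as an element of `Fin 2`. -/
def zeroBit {n : ℕ} (a : Fin (n + 2)) : Fin 2 := if a = 0 then 0 else 1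

/-- The positions at which `π` correctly predicts the zero pattern of `x`. -/
def Hit {n : ℕ} (π : List (Fin 2) → Fin 2) (x : ℕ → Fin (n + 2)) (i : ℕ) : Prop :=
  zeroBit (x i) = π (seg (fun j => zeroBit (x j)) i)

/-- The subsequence of `x` along the positions in `Hit π x`, with nonzero letters shifted down. -/
noncomputable def hitSeq {n : ℕ} (π : List (Fin 2) → Fin 2) (x : ℕ → Fin (n + 2)) (j : ℕ) :
    Fin (n + 1) :=
  Fin.predAbove 0 (x (Nat.nth (Hit π x) j))

/-- One step of the computation of `hitSeq` on finite sequences; the first component of the state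
is the input read so far. -/
def hitStep {n : ℕ} (π : List (Fin 2) → Fin 2) (st : List (Fin (n + 2)) × List (Fin (n + 1)))
    (a : Fin (n + 2)) : List (Fin (n + 2)) × List (Fin (n + 1)) :=
  (st.1 ++ [a],
    if zeroBit a = π (st.1.map zeroBit) then st.2 ++ [Fin.predAbove 0 a] else st.2)

open Classical in
theorem foldl_hitStep_seg {n : ℕ} (π : List (Fin 2) → Fin 2) (x : ℕ → Fin (n + 2)) (i : ℕ) :
    (seg x i).foldl (hitStep π) ([], []) =
      (seg x i, seg (hitSeq π x) (Nat.count (Hit π x) i)) := by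
  induction i with
  | zero => simp [seg]
  | succ i ih =>
    rw [seg_succ, List.foldl_append, ih]
    by_cases h : Hit π x i
    · have h' := h
      rw [Hit] at h'
      simp [hitStep, map_seg, h', Nat.count_succ, h, seg_succ, hitSeq, Nat.nth_count]
    · have h' := h
      rw [Hit] at h'
      simp [hitStep, map_seg, h', Nat.count_succ, h]

/-- The predictor that lets `π` decide whether the next letter is `0`, and otherwise uses `ρ` on
the subsequence of letters whose zero pattern was predicted by `π`. -/
def combine {n : ℕ} (π : List (Fin 2) → Fin 2) (ρ : List (Fin (n + 1)) → Fin (n + 1))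
    (s : List (Fin (n + 2))) : Fin (n + 2) :=
  if π (s.map zeroBit) = 0 then 0 else (ρ (s.foldl (hitStep π) ([], [])).2).succ

open Classical in
theorem eq_combine {n : ℕ} {π : List (Fin 2) → Fin 2} {ρ : List (Fin (n + 1)) → Fin (n + 1)}
    {x : ℕ → Fin (n + 2)} {i : ℕ} (hi : Hit π x i)
    (hρ : hitSeq π x (Nat.count (Hit π x) i) =
      ρ (seg (hitSeq π x) (Nat.count (Hit π x) i))) :
    x i = combine π ρ (seg x i) := by
  rw [combine, foldl_hitStep_seg, ← hρ, map_seg, ← hi, hitSeq, Nat.nth_count hi]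
  by_cases h : x i = 0
  · simp [zeroBit, h]
  · obtain ⟨a, ha⟩ := Fin.exists_succ_eq.2 h
    simp [zeroBit, ← ha]

theorem Nat.add_le_count_of_windows {P : ℕ → Prop} [DecidablePred P] {k N : ℕ}
    (hP : ∀ m, N ≤ m → ∃ i, m ≤ i ∧ i < m + k ∧ P i) {m : ℕ} (hm : N ≤ m) (l : ℕ) :
    Nat.count P m + l ≤ Nat.count P (m + k * l) := by
  induction l with
  | zero => simp
  | succ l ih =>
    obtain ⟨i, h₁, h₂, hi⟩ := hP (m + k * l) (by omega)
    have h₃ := Nat.count_monotone P h₁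
    have h₄ := Nat.count_strict_mono hi h₂
    rw [Nat.mul_succ, ← Nat.add_assoc m]
    omega

theorem KPred.combine {n k l : ℕ} {π : List (Fin 2) → Fin 2}
    {ρ : List (Fin (n + 1)) → Fin (n + 1)} {x : ℕ → Fin (n + 2)}
    (hπ : KPred k π fun i => zeroBit (x i)) (hρ : KPred l ρ (hitSeq π x)) :
    KPred (k * l) (combine π ρ) x := by
  classical
  obtain ⟨N, hN⟩ := hπ
  obtain ⟨M, hM⟩ := hρ
  have hinf : (Set.ofPred (Hit π x)).Infinite := by
    refine Set.infinite_of_not_bddAbove fun ⟨b, hb⟩ => ?_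
    obtain ⟨i, h₁, -, hi⟩ := hN (max N (b + 1)) (le_max_left _ _)
    have : i ≤ b := hb hi
    omega
  refine ⟨max N (Nat.nth (Hit π x) M), fun m hm => ?_⟩
  have hMm : M ≤ Nat.count (Hit π x) m := by
    rw [← Nat.count_nth_of_infinite hinf M]
    exact Nat.count_monotone _ ((le_max_right _ _).trans hm)
  obtain ⟨j, h₁, h₂, hj⟩ := hM _ hMm
  refine ⟨Nat.nth (Hit π x) j, ?_, ?_, eq_combine (Nat.nth_mem_of_infinite hinf j) ?_⟩
  · exact (Nat.count_le_iff_le_nth hinf).1 h₁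
  · exact Nat.nth_lt_of_lt_count
      (h₂.trans_le (Nat.add_le_count_of_windows (P := Hit π x) hN ((le_max_left _ _).trans hm) l))
  · rwa [Nat.count_nth_of_infinite hinf]

theorem min_eConst_le_eConst_mul (n k l : ℕ) :
    min (eConst 2 k) (eConst (n + 1) l) ≤ eConst (n + 2) (k * l) := by
  obtain ⟨F, hF, hev⟩ := exists_mk_eq_eConst (n := n + 2) (by omega) (k * l)
  by_contra! h
  rw [← hF, lt_min_iff] at h
  obtain ⟨π, hπ⟩ := exists_predictor_of_lt_eConst
    ((mk_image_le (f := fun x i => zeroBit (x i)) (s := F)).trans_lt h.1)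
  obtain ⟨ρ, hρ⟩ := exists_predictor_of_lt_eConst
    ((mk_image_le (f := hitSeq π) (s := F)).trans_lt h.2)
  obtain ⟨x, hx, hnot⟩ := hev (combine π ρ)
  exact hnot ((hπ _ ⟨x, hx, rfl⟩).combine (hρ _ ⟨x, hx, rfl⟩))

theorem eConst_two_le_eConst_pow (n k : ℕ) : eConst 2 k ≤ eConst (n + 2) (k ^ (n + 1)) := by
  induction n with
  | zero => simp
  | succ n ih =>
    rw [pow_succ']
    exact (le_min le_rfl ih).trans (min_eConst_le_eConst_mul (n + 1) k _)

/-- `sup{ 𝔢ₙᶜᵒⁿˢᵗ(k) : k ≥ 1 } = sup{ 𝔢₂ᶜᵒⁿˢᵗ(k) : k ≥ 1 }` for all `n ≥ 2`. -/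
theorem stmt7 (n : ℕ) (hn : 2 ≤ n) :
    (⨆ k : ℕ, eConst n (k + 1)) = ⨆ k : ℕ, eConst 2 (k + 1) := by
  refine le_antisymm ?_ ?_
  · exact ciSup_mono (bddAbove_of_small) fun k => eConst_anti le_rfl hn (k + 1)
  · refine ciSup_le' fun k => ?_
    obtain ⟨n, rfl⟩ := Nat.exists_eq_add_of_le' hn
    have hpos : 0 < (k + 1) ^ (n + 1) := by positivity
    have h := eConst_two_le_eConst_pow n (k + 1)
    rw [← Nat.sub_add_cancel hpos] at h
    exact h.trans (le_ciSup (f := fun k => eConst (n + 2) (k + 1)) bddAbove_of_small _)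
end
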